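/- arXiv:1409.7983 — 3 statements merged into one kernel-verified Lean document; each statement's English description precedes it below -/
import Mathlib

section
/- Let VGS_{k,m} be a very generalized star with leg-vertex degrees k_{ij} (1 ≤ i ≤ k, 1 ≤ j ≤ m), and let r = min over 1 ≤ i ≤ k of max(k_{i1}, k_{i2}). Suppose there exist two distinct legs i ≠ j with k_{i1} ≥ r and k_{j1} ≥ r, that m ≤ P_{k−1}(Q_{k−1}), and that r ≥ k. Then for all sufficiently large n, sat(Q_n, VGS_{k,m}) ≤ r · 2^(n−1). -/
open SimpleGraph

/-- The hypercube graph `Q_n` on vertex set `{0,1}^n`: two vertices are adjacent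
iff they differ in exactly one coordinate. -/
def hypercube (n : ℕ) : SimpleGraph (Fin n → Bool) :=
  SimpleGraph.fromRel (fun u v => hammingDist u v = 1)

/-- `HasCopy H G` means `H` contains a subgraph isomorphic to `G`. -/
def HasCopy {V W : Type*} (H : SimpleGraph V) (G : SimpleGraph W) : Prop :=
  ∃ f : G →g H, Function.Injective f

/-- `IsSat Host H G`: `H` is an `(Host, G)`-saturated subgraph of `Host`. -/
def IsSat {V W : Type*} (Host H : SimpleGraph V) (G : SimpleGraph W) : Prop :=
  H ≤ Host ∧ ¬ HasCopy H G ∧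
    ∀ u v : V, Host.Adj u v → ¬ H.Adj u v →
      HasCopy (H ⊔ SimpleGraph.fromEdgeSet {s(u, v)}) G

/-- The saturation number `sat(Host, G)`. -/
noncomputable def satNum {V W : Type*} (Host : SimpleGraph V) (G : SimpleGraph W) : ℕ :=
  sInf { m | ∃ H : SimpleGraph V, IsSat Host H G ∧ H.edgeSet.ncard = m }

/-- Number of non-leaf neighbors of the `j`-th vertex (0-based, counted from the
center) on a leg of length `m` of a very generalized star. -/
def legExtra (m j : ℕ) : ℕ := if j = m - 1 then 1 else 2

/-- The very generalized star `VGS_{k,m}` with leg-vertex degrees `kk i j`: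
the generalized star `GS_{k,m}` with leaves attached so that the `(j+1)`-th
vertex from the center on leg `i+1` has degree `kk i j` (0-based `i, j`;
the paper's `k_{ij}` is `kk (i-1) (j-1)`). -/
def vgs (k m : ℕ) (kk : ℕ → ℕ → ℕ) :
    SimpleGraph (Unit ⊕ (Fin k × Fin m) ⊕
      Σ p : Fin k × Fin m, Fin (kk (p.1 : ℕ) (p.2 : ℕ) - legExtra m (p.2 : ℕ))) :=
  SimpleGraph.fromRel (fun u v =>
    match u, v with
    | Sum.inl _, Sum.inr (Sum.inl p) => (p.2 : ℕ) = 0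
    | Sum.inr (Sum.inl p), Sum.inr (Sum.inl q) => p.1 = q.1 ∧ (p.2 : ℕ) + 1 = (q.2 : ℕ)
    | Sum.inr (Sum.inl p), Sum.inr (Sum.inr q) => p = q.1
    | _, _ => False)

/-- `hasFan k j ℓ`: `Q_k` contains `j` paths of length `ℓ` all starting at a common
vertex `v` and pairwise sharing no vertex other than `v`. -/
def hasFan (k j ℓ : ℕ) : Prop :=
  ∃ (v : Fin k → Bool) (e : Fin j → (Fin k → Bool))
    (p : ∀ i : Fin j, (hypercube k).Walk v (e i)),
      (∀ i, (p i).IsPath) ∧ (∀ i, (p i).length = ℓ) ∧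
      ∀ i i', i ≠ i' → ∀ x, x ∈ (p i).support → x ∈ (p i').support → x = v

/-- `P_j(Q_k)`. -/
noncomputable def Pfan (j k : ℕ) : ℕ := sSup { ℓ | hasFan k j ℓ }

/-- The vertex of the cube obtained from `u` by changing coordinate `i`. -/
def flipAt {n : ℕ} (i : Fin n) (u : Fin n → Bool) : Fin n → Bool :=
  Function.update u i (!u i)

@[simp] lemma flipAt_same {n : ℕ} (i : Fin n) (u : Fin n → Bool) : flipAt i u i = !u i := by
  simp [flipAt]

lemma flipAt_of_ne {n : ℕ} {i a : Fin n} (h : a ≠ i) (u : Fin n → Bool) :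
    flipAt i u a = u a := by
  simp [flipAt, h]

@[simp] lemma flipAt_flipAt {n : ℕ} (i : Fin n) (u : Fin n → Bool) :
    flipAt i (flipAt i u) = u := by
  simp [flipAt]

lemma flipAt_ne {n : ℕ} (i : Fin n) (u : Fin n → Bool) : flipAt i u ≠ u := by
  intro h
  have := congrFun h i
  simp at this

lemma flipAt_left_injective {n : ℕ} (u : Fin n → Bool) :
    Function.Injective fun i => flipAt i u := by
  intro i j h
  by_contra hij
  have := congrFun h i
  simp [flipAt_of_ne hij] at this

lemma eq_flipAt_comm {n : ℕ} {i : Fin n} {u v : Fin n → Bool} (h : v = flipAt i u) :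
    u = flipAt i v := by
  rw [h, flipAt_flipAt]

lemma hypercube_adj {n : ℕ} {u v : Fin n → Bool} :
    (hypercube n).Adj u v ↔ ∃ i, v = flipAt i u := by
  have key : hammingDist u v = 1 ↔ ∃ i, v = flipAt i u := by
    rw [hammingDist, Finset.card_eq_one]
    refine exists_congr fun i => ⟨fun h => ?_, fun h => ?_⟩
    · funext a
      have ha := Finset.ext_iff.1 h a
      simp only [Finset.mem_filter, Finset.mem_univ, true_and, Finset.mem_singleton] at ha
      by_cases hai : a = i
      · subst hai
        have : u a ≠ v a := ha.2 rfl
        rw [flipAt_same]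
        revert this
        cases u a <;> cases v a <;> simp
      · rw [flipAt_of_ne hai]
        by_contra hne
        exact hai (ha.1 (Ne.symm hne))
    · subst h
      ext a
      by_cases hai : a = i
      · subst hai; simp
      · simp [flipAt_of_ne hai, hai]
  rw [hypercube, SimpleGraph.fromRel_adj, hammingDist_comm v u, or_self, key]
  refine ⟨fun h => h.2, fun h => ⟨?_, h⟩⟩
  obtain ⟨i, rfl⟩ := h
  exact (flipAt_ne i u).symm

/-- The sum of the weights `γ i` over the coordinates `i` at which `u` is `true`. -/
def weightedSum {n : ℕ} {G : Type*} [AddCommGroup G] (γ : Fin n → G) (u : Fin n → Bool) : G :=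
  ∑ i, if u i then γ i else 0

lemma weightedSum_flipAt {n : ℕ} {G : Type*} [AddCommGroup G] (h2 : ∀ g : G, g + g = 0)
    (γ : Fin n → G) (i : Fin n) (u : Fin n → Bool) :
    weightedSum γ (flipAt i u) = weightedSum γ u + γ i := by
  unfold weightedSum
  rw [← Finset.add_sum_erase _ _ (Finset.mem_univ i),
    ← Finset.add_sum_erase Finset.univ (fun j => if u j then γ j else 0) (Finset.mem_univ i)]
  have : ∀ j ∈ Finset.univ.erase i, (if flipAt i u j then γ j else 0) = if u j then γ j else 0 :=
    fun j hj => by rw [flipAt_of_ne (Finset.ne_of_mem_erase hj)]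
  rw [Finset.sum_congr rfl this, flipAt_same]
  cases u i
  · simp [add_comm]
  · simp only [Bool.not_true, Bool.false_eq_true, if_false, if_true]
    rw [add_right_comm, h2]

/-- The parity of the number of `true` coordinates. -/
def parity {n : ℕ} (u : Fin n → Bool) : ZMod 2 := weightedSum (fun _ => 1) u

lemma parity_flipAt {n : ℕ} (i : Fin n) (u : Fin n → Bool) :
    parity (flipAt i u) = parity u + 1 :=
  weightedSum_flipAt (by decide) _ i u

/-- A labelling of the coordinates of the cube `Q_n` by syndromes in an elementary abelian
`2`-group `G`.  Every syndrome `g` labels at least two coordinates `κ g 0` and `κ g 1`, and the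
coordinates `τ j`, as well as those in `T`, have syndrome `0`. -/
structure CubeLabelling (n k s : ℕ) (G : Type) [AddCommGroup G] where
  add_self : ∀ g : G, g + g = 0
  γ : Fin n → G
  κ : G → ZMod 2 → Fin n
  τ : Fin k → Fin n
  T : Finset (Fin n)
  γ_κ : ∀ g b, γ (κ g b) = g
  κ_inj : ∀ {g g' b b'}, κ g b = κ g' b' → b = b'
  τ_inj : Function.Injective τ
  γ_τ : ∀ j, γ (τ j) = 0
  κ_ne_τ : ∀ g b j, κ g b ≠ τ j
  γ_T : ∀ i ∈ T, γ i = 0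
  card_T : T.card = s

lemma exists_cubeLabelling (t k s n : ℕ) (hn : 2 ^ t * 2 + (k + s) ≤ n) :
    Nonempty (CubeLabelling n k s (Fin t → ZMod 2)) := by
  obtain ⟨e⟩ : Nonempty (((Fin t → ZMod 2) × ZMod 2) ⊕ (Fin k ⊕ Fin s) ↪ Fin n) := by
    apply Function.Embedding.nonempty_of_card_le
    simpa [ZMod.card] using hn
  have hγ : ∀ x, Function.extend e (Sum.elim Prod.fst fun _ => 0) (fun _ => 0) (e x) =
      Sum.elim Prod.fst (fun _ => (0 : Fin t → ZMod 2)) x :=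
    e.injective.extend_apply _ _
  refine ⟨{ add_self := fun g => funext fun a => ?_
            γ := Function.extend e (Sum.elim Prod.fst fun _ => 0) fun _ => 0
            κ := fun g b => e (Sum.inl (g, b))
            τ := fun j => e (Sum.inr (Sum.inl j))
            T := Finset.univ.image fun j => e (Sum.inr (Sum.inr j))
            γ_κ := fun g b => ?_
            κ_inj := fun h => ?_
            τ_inj := fun i j h => ?_
            γ_τ := fun j => ?_
            κ_ne_τ := fun g b j h => ?_
            γ_T := fun i hi => ?_
            card_T := ?_ }⟩
  · simpa using CharTwo.add_self_eq_zero (g a)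
  · rw [hγ]; rfl
  · simpa using congrArg Prod.snd (Sum.inl_injective (e.injective h))
  · simpa using h
  · rw [hγ]; rfl
  · simp at h
  · obtain ⟨j, -, rfl⟩ := Finset.mem_image.1 hi
    rw [hγ]; rfl
  · rw [Finset.card_image_of_injective, Finset.card_univ, Fintype.card_fin]
    intro i j h
    simpa using h

namespace CubeLabelling

variable {n k s : ℕ} {G : Type} [AddCommGroup G] (D : CubeLabelling n k s G)

/-- The syndrome of a vertex; the vertices with syndrome `0` are the vertices of large degree. -/
def syn (u : Fin n → Bool) : G := weightedSum D.γ u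

lemma syn_flipAt (i : Fin n) (u : Fin n → Bool) : D.syn (flipAt i u) = D.syn u + D.γ i :=
  weightedSum_flipAt D.add_self _ i u

/-- The vertex of syndrome `0` assigned to `u`. -/
def rep (u : Fin n → Bool) : Fin n → Bool := flipAt (D.κ (D.syn u) (parity u)) u

@[simp] lemma syn_rep (u : Fin n → Bool) : D.syn (D.rep u) = 0 := by
  rw [rep, syn_flipAt, γ_κ, D.add_self]

/-- The saturated subgraph: subcubes in the directions `τ` on the vertices of syndrome `0`,
subcubes in the directions `T` on the others, and all edges from `u` to `rep u`. -/
def graph : SimpleGraph (Fin n → Bool) where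
  Adj u v := (D.syn u = 0 ∧ ∃ j, v = flipAt (D.τ j) u) ∨
    (D.syn u ≠ 0 ∧ ∃ i ∈ D.T, v = flipAt i u) ∨
    (D.syn u ≠ 0 ∧ v = D.rep u) ∨ (D.syn v ≠ 0 ∧ u = D.rep v)
  symm := ⟨by
    rintro u v (⟨h, j, rfl⟩ | ⟨h, i, hi, rfl⟩ | ⟨h, h'⟩ | ⟨h, h'⟩)
    · exact Or.inl ⟨by rw [syn_flipAt, h, γ_τ, add_zero], j, by simp⟩
    · exact Or.inr (Or.inl ⟨by rwa [syn_flipAt, D.γ_T i hi, add_zero], i, hi, by simp⟩)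
    · exact Or.inr (Or.inr (Or.inr ⟨h, h'⟩))
    · exact Or.inr (Or.inr (Or.inl ⟨h, h'⟩))⟩
  loopless := ⟨by
    rintro u (⟨h, j, h'⟩ | ⟨h, i, hi, h'⟩ | ⟨h, h'⟩ | ⟨h, h'⟩)
    · exact flipAt_ne _ _ h'.symm
    · exact flipAt_ne _ _ h'.symm
    · exact flipAt_ne _ _ h'.symm
    · exact flipAt_ne _ _ h'.symm⟩

lemma graph_le : D.graph ≤ hypercube n := by
  rintro u v (⟨h, j, h'⟩ | ⟨h, i, hi, h'⟩ | ⟨h, h'⟩ | ⟨h, h'⟩)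
  · exact hypercube_adj.2 ⟨_, h'⟩
  · exact hypercube_adj.2 ⟨_, h'⟩
  · exact hypercube_adj.2 ⟨_, h'⟩
  · exact hypercube_adj.2 ⟨_, eq_flipAt_comm h'⟩

lemma graph_adj_rep {u : Fin n → Bool} (h : D.syn u ≠ 0) : D.graph.Adj u (D.rep u) :=
  Or.inr (Or.inr (Or.inl ⟨h, rfl⟩))

lemma eq_rep_of_adj {u v : Fin n → Bool} (hu : D.syn u ≠ 0) (hv : D.syn v = 0)
    (h : D.graph.Adj u v) : v = D.rep u := by
  rcases h with ⟨h, -⟩ | ⟨-, i, hi, rfl⟩ | ⟨-, h⟩ | ⟨h, -⟩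
  · exact absurd h hu
  · rw [syn_flipAt, D.γ_T i hi, add_zero] at hv
    exact absurd hv hu
  · exact h
  · exact absurd hv h

/-- The neighbours of `u` in directions `T`. -/
def side (u : Fin n → Bool) : Finset (Fin n → Bool) := D.T.image fun i => flipAt i u

lemma card_side (u : Fin n → Bool) : (D.side u).card = s := by
  rw [side, Finset.card_image_of_injective _ (flipAt_left_injective u), D.card_T]

lemma mem_side {u z : Fin n → Bool} : z ∈ D.side u ↔ ∃ i ∈ D.T, flipAt i u = z :=
  Finset.mem_image

lemma syn_of_mem_side {u z : Fin n → Bool} (h : z ∈ D.side u) : D.syn z = D.syn u := by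
  obtain ⟨i, hi, rfl⟩ := D.mem_side.1 h
  rw [syn_flipAt, D.γ_T i hi, add_zero]

lemma parity_of_mem_side {u z : Fin n → Bool} (h : z ∈ D.side u) : parity z = parity u + 1 := by
  obtain ⟨i, hi, rfl⟩ := D.mem_side.1 h
  exact parity_flipAt i u

lemma graph_adj_of_mem_side {u z : Fin n → Bool} (hu : D.syn u ≠ 0) (h : z ∈ D.side u) :
    D.graph.Adj u z := by
  obtain ⟨i, hi, rfl⟩ := D.mem_side.1 h
  exact Or.inr (Or.inl ⟨hu, i, hi, rfl⟩)

lemma mem_of_adj {u v : Fin n → Bool} (hu : D.syn u ≠ 0) (h : D.graph.Adj u v) :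
    v ∈ insert (D.rep u) (D.side u) := by
  rw [Finset.mem_insert, mem_side]
  rcases h with ⟨h, -⟩ | ⟨-, i, hi, rfl⟩ | ⟨-, h⟩ | ⟨-, h⟩
  · exact absurd h hu
  · exact Or.inr ⟨i, hi, rfl⟩
  · exact Or.inl h
  · exact absurd (h ▸ D.syn_rep v) hu

lemma exists_τ_of_adj {u v : Fin n → Bool} (hu : D.syn u = 0) (hv : D.syn v = 0)
    (h : D.graph.Adj u v) : ∃ j, v = flipAt (D.τ j) u := by
  rcases h with ⟨-, h⟩ | ⟨h, -⟩ | ⟨h, -⟩ | ⟨h, -⟩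
  · exact h
  · exact absurd hu h
  · exact absurd hu h
  · exact absurd hv h

lemma two_mul_ncard_edgeSet_le {r : ℕ} (hk : k ≤ r) (hs : s + 2 ≤ r) :
    2 * D.graph.edgeSet.ncard ≤ r * 2 ^ n := by
  classical
  let F : (Fin n → Bool) → Finset ((Fin n → Bool) × (Fin n → Bool)) := fun u =>
    if D.syn u = 0 then Finset.univ.image fun j => (u, flipAt (D.τ j) u)
    else (D.side u).image (fun z => (u, z)) ∪ {(u, D.rep u), (D.rep u, u)}
  have hF : ∀ u, (F u).card ≤ r := by
    intro u
    simp only [F]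
    split_ifs
    · exact Finset.card_image_le.trans (by simpa using hk)
    · refine (Finset.card_union_le _ _).trans (le_trans ?_ hs)
      exact Nat.add_le_add (Finset.card_image_le.trans (D.card_side u).le) Finset.card_le_two
  have hcard : Fintype.card D.graph.Dart ≤ (Finset.univ.biUnion F).card := by
    rw [← Finset.card_univ]
    refine Finset.card_le_card_of_injOn (fun d => d.toProd) (fun d _ => ?_)
      (fun d _ d' _ h => SimpleGraph.Dart.ext _ _ h)
    rw [Finset.mem_coe, Finset.mem_biUnion]
    obtain ⟨⟨u, v⟩, h⟩ := d
    rcases h with ⟨h, j, h'⟩ | ⟨h, i, hi, h'⟩ | ⟨h, h'⟩ | ⟨h, h'⟩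
    · exact ⟨u, Finset.mem_univ _, by simp [F, show D.syn u = 0 from h, show v = _ from h']⟩
    · refine ⟨u, Finset.mem_univ _, ?_⟩
      have hv : v ∈ D.side u := D.mem_side.2 ⟨i, hi, Eq.symm h'⟩
      simp [F, show D.syn u ≠ 0 from h, hv]
    · exact ⟨u, Finset.mem_univ _, by simp [F, show D.syn u ≠ 0 from h, show v = _ from h']⟩
    · exact ⟨v, Finset.mem_univ _, by simp [F, show D.syn v ≠ 0 from h, show u = _ from h']⟩
  rw [D.graph.dart_card_eq_twice_card_edges, ← Set.ncard_coe_finset,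
    SimpleGraph.coe_edgeFinset] at hcard
  refine hcard.trans (Finset.card_biUnion_le.trans ?_)
  refine (Finset.sum_le_card_nsmul _ _ r fun u _ => hF u).trans ?_
  simp [mul_comm]

end CubeLabelling

section VeryGeneralizedStar

variable {k m : ℕ} {kk : ℕ → ℕ → ℕ}

lemma vgs_adj_center {p : Fin k × Fin m} (h : (p.2 : ℕ) = 0) :
    (vgs k m kk).Adj (Sum.inl ()) (Sum.inr (Sum.inl p)) :=
  ⟨by simp, Or.inl h⟩

lemma vgs_adj_leg {p q : Fin k × Fin m} (h : p.1 = q.1) (h' : (p.2 : ℕ) + 1 = q.2) :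
    (vgs k m kk).Adj (Sum.inr (Sum.inl p)) (Sum.inr (Sum.inl q)) := by
  refine ⟨?_, Or.inl ⟨h, h'⟩⟩
  rintro ⟨⟩
  omega

lemma vgs_adj_leaf (p : Fin k × Fin m)
    (x : Fin (kk (p.1 : ℕ) (p.2 : ℕ) - legExtra m (p.2 : ℕ))) :
    (vgs k m kk).Adj (Sum.inr (Sum.inl p)) (Sum.inr (Sum.inr ⟨p, x⟩)) :=
  ⟨by simp, Or.inl rfl⟩

lemma le_card_of_adj_leg {V : Type*} {H : SimpleGraph V} (f : vgs k m kk →g H)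
    (hf : Function.Injective f) (p : Fin k × Fin m) (S : Finset V)
    (hS : ∀ v, H.Adj (f (Sum.inr (Sum.inl p))) v → v ∈ S) :
    kk p.1 p.2 ≤ S.card := by
  classical
  have key : ∀ A : Finset _, (∀ a ∈ A, (vgs k m kk).Adj (Sum.inr (Sum.inl p)) a) →
      A.card ≤ S.card := fun A hA =>
    Finset.card_le_card_of_injOn f (fun a ha => hS _ (f.map_adj (hA a ha))) hf.injOn
  let leaf : Fin (kk (p.1 : ℕ) (p.2 : ℕ) - legExtra m (p.2 : ℕ)) →
      Unit ⊕ (Fin k × Fin m) ⊕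
        Σ p : Fin k × Fin m, Fin (kk (p.1 : ℕ) (p.2 : ℕ) - legExtra m (p.2 : ℕ)) :=
    fun x => Sum.inr (Sum.inr ⟨p, x⟩)
  have hleaf : (Finset.univ.image leaf).card = kk p.1 p.2 - legExtra m p.2 := by
    rw [Finset.card_image_of_injective, Finset.card_univ, Fintype.card_fin]
    intro x y h
    simpa [leaf] using h
  have hleaf_adj : ∀ a ∈ Finset.univ.image leaf, (vgs k m kk).Adj (Sum.inr (Sum.inl p)) a := by
    intro a ha
    obtain ⟨x, -, rfl⟩ := Finset.mem_image.1 ha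
    exact vgs_adj_leaf p x
  obtain ⟨prev, hprev, hprev_leaf, hprev_next⟩ : ∃ a, (vgs k m kk).Adj (Sum.inr (Sum.inl p)) a ∧
      a ∉ Finset.univ.image leaf ∧
      ∀ q : Fin k × Fin m, (p.2 : ℕ) + 1 = q.2 → Sum.inr (Sum.inl q) ≠ a := by
    by_cases h0 : (p.2 : ℕ) = 0
    · exact ⟨Sum.inl (), (vgs_adj_center h0).symm, by simp [leaf], by simp⟩
    · refine ⟨Sum.inr (Sum.inl (p.1, ⟨p.2 - 1, by omega⟩)),
        (vgs_adj_leg (p := (p.1, ⟨p.2 - 1, by omega⟩)) (q := p) rfl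
          (Nat.sub_add_cancel (Nat.pos_of_ne_zero h0))).symm, by simp [leaf], ?_⟩
      rintro q hq h
      simp only [Sum.inr.injEq, Sum.inl.injEq] at h
      subst h
      simp at hq
      omega
  have hp2 := p.2.isLt
  by_cases hlast : (p.2 : ℕ) = m - 1
  · have := key (insert prev (Finset.univ.image leaf)) (by
      intro a ha
      rcases Finset.mem_insert.1 ha with rfl | ha
      exacts [hprev, hleaf_adj a ha])
    rw [Finset.card_insert_of_notMem hprev_leaf, hleaf, legExtra, if_pos hlast] at this
    omega
  · have hlt : (p.2 : ℕ) + 1 < m := by omega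
    have hnext : (vgs k m kk).Adj (Sum.inr (Sum.inl p))
        (Sum.inr (Sum.inl (p.1, ⟨p.2 + 1, hlt⟩))) := vgs_adj_leg rfl rfl
    have := key (insert (Sum.inr (Sum.inl (p.1, ⟨p.2 + 1, hlt⟩)))
        (insert prev (Finset.univ.image leaf))) (by
      intro a ha
      rcases Finset.mem_insert.1 ha with rfl | ha
      · exact hnext
      rcases Finset.mem_insert.1 ha with rfl | ha
      exacts [hprev, hleaf_adj a ha])
    rw [Finset.card_insert_of_notMem, Finset.card_insert_of_notMem hprev_leaf, hleaf, legExtra,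
      if_neg hlast] at this
    · omega
    · rw [Finset.mem_insert, not_or]
      exact ⟨hprev_next _ rfl, by simp [leaf]⟩

lemma hasCopy_vgs {V : Type*} {H : SimpleGraph V} (c : V) (w : Fin k × Fin m → V)
    (N : Fin k × Fin m → Finset V) (hw : Function.Injective w) (hc : ∀ p, w p ≠ c)
    (hfirst : ∀ p, (p.2 : ℕ) = 0 → H.Adj c (w p))
    (hnext : ∀ p q, p.1 = q.1 → (p.2 : ℕ) + 1 = q.2 → H.Adj (w p) (w q))
    (hN : ∀ p, ∀ z ∈ N p, H.Adj (w p) z ∧ z ≠ c ∧ ∀ q, z ≠ w q)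
    (hdisj : ∀ p q, p ≠ q → Disjoint (N p) (N q))
    (hcard : ∀ p, kk p.1 p.2 - legExtra m p.2 ≤ (N p).card) :
    HasCopy H (vgs k m kk) := by
  have hemb : ∀ p : Fin k × Fin m, Nonempty (Fin (kk p.1 p.2 - legExtra m p.2) ↪ N p) :=
    fun p => Function.Embedding.nonempty_of_card_le (by simpa using hcard p)
  let e := fun p => (hemb p).some
  let f : (Unit ⊕ (Fin k × Fin m) ⊕
      Σ p : Fin k × Fin m, Fin (kk (p.1 : ℕ) (p.2 : ℕ) - legExtra m (p.2 : ℕ))) → V :=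
    Sum.elim (fun _ => c) (Sum.elim w fun x => (e x.1 x.2 : V))
  have hrel : ∀ {u v}, (match u, v with
      | Sum.inl _, Sum.inr (Sum.inl p) => (p.2 : ℕ) = 0
      | Sum.inr (Sum.inl p), Sum.inr (Sum.inl q) => p.1 = q.1 ∧ (p.2 : ℕ) + 1 = (q.2 : ℕ)
      | Sum.inr (Sum.inl p), Sum.inr (Sum.inr q) => p = q.1
      | _, _ => False) → H.Adj (f u) (f v) := by
    rintro (u | p | x) (v | q | y) h
    · exact h.elim
    · exact hfirst q h
    · exact h.elim
    · exact h.elim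
    · exact hnext p q h.1 h.2
    · obtain ⟨q, y⟩ := y
      obtain rfl : p = q := h
      exact (hN p _ (e p y).2).1
    · exact h.elim
    · exact h.elim
    · exact h.elim
  refine ⟨⟨f, fun {u v} h => ?_⟩, ?_⟩
  · rcases h.2 with h | h
    · exact hrel h
    · exact (hrel h).symm
  · change Function.Injective f
    rintro (u | p | ⟨p, x⟩) (v | q | ⟨q, y⟩) h
    · rfl
    · exact absurd h.symm (hc q)
    · exact absurd h.symm (hN q _ (e q y).2).2.1
    · exact absurd h (hc p)
    · rw [hw h]
    · exact absurd h.symm ((hN q _ (e q y).2).2.2 p)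
    · exact absurd h (hN p _ (e p x).2).2.1
    · exact absurd h ((hN p _ (e p x).2).2.2 q)
    · have h : (e p x : V) = e q y := h
      by_cases hpq : p = q
      · subst hpq
        rw [(e p).injective (Subtype.ext h)]
      · refine absurd ?_ (Finset.disjoint_left.1 (hdisj p q hpq) (e p x).2)
        rw [h]
        exact (e q y).2

end VeryGeneralizedStar

lemma exists_fan_of_le_Pfan {m j k : ℕ} (hm : 0 < m) (h : m ≤ Pfan j k) :
    ∃ (v : Fin k → Bool) (g : Fin j → ℕ → Fin k → Bool), (∀ i, g i 0 = v) ∧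
      (∀ i, ∀ a < m, ∃ t, g i (a + 1) = flipAt t (g i a)) ∧
      ∀ i i' a a', a ≤ m → a' ≤ m → g i a = g i' a' → a = a' ∧ (i = i' ∨ a = 0) := by
  have hmem : Pfan j k ∈ {ℓ | hasFan k j ℓ} := by
    have hpos : 0 < Pfan j k := hm.trans_le h
    apply Nat.sSup_mem
    · by_contra hne
      rw [Set.not_nonempty_iff_eq_empty] at hne
      simp [Pfan, hne] at hpos
    · by_contra hbdd
      rw [Pfan, Nat.sSup_of_not_bddAbove hbdd] at hpos
      exact hpos.false
  obtain ⟨v, e, p, hpath, hlen, hdisj⟩ := hmem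
  have hinj : ∀ i a a', a ≤ m → a' ≤ m → (p i).getVert a = (p i).getVert a' → a = a' :=
    fun i a a' ha ha' hh => (hpath i).getVert_injOn
      (by simp [hlen i, ha.trans h]) (by simp [hlen i, ha'.trans h]) hh
  refine ⟨v, fun i a => (p i).getVert a, fun i => (p i).getVert_zero, fun i a ha => ?_,
    fun i i' a a' ha ha' hh => ?_⟩
  · exact hypercube_adj.1 ((p i).adj_getVert_succ (by rw [hlen i]; omega))
  · by_cases hii : i = i'
    · subst hii
      exact ⟨hinj i a a' ha ha' hh, Or.inl rfl⟩
    · have hv := hdisj i i' hii _ ((p i).getVert_mem_support a)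
        (by rw [show (p i).getVert a = _ from hh]; exact (p i').getVert_mem_support a')
      have h0 : a = 0 := hinj i a 0 ha hm.le (by rw [hv, SimpleGraph.Walk.getVert_zero])
      have h0' : a' = 0 := hinj i' a' 0 ha' hm.le
        (by rw [← show (p i).getVert a = (p i').getVert a' from hh, hv,
          SimpleGraph.Walk.getVert_zero])
      exact ⟨by rw [h0, h0'], Or.inr h0⟩

namespace CubeLabelling

variable {n k s : ℕ} {G : Type} [AddCommGroup G] (D : CubeLabelling n k s G)

lemma not_hasCopy_graph {m r : ℕ} {kk : ℕ → ℕ → ℕ} (hm : 2 ≤ m) (hs : s + 2 ≤ r)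
    (hr_le : ∀ i < k + 1, r ≤ max (kk i 0) (kk i 1))
    (hpair : ∃ i < k + 1, ∃ j < k + 1, i ≠ j ∧ r ≤ kk i 0 ∧ r ≤ kk j 0) :
    ¬ HasCopy D.graph (vgs (k + 1) m kk) := by
  classical
  rintro ⟨f, hf⟩
  have hsyn : ∀ p : Fin (k + 1) × Fin m, r ≤ kk p.1 p.2 →
      D.syn (f (Sum.inr (Sum.inl p))) = 0 := by
    intro p hp
    by_contra hne
    have := le_card_of_adj_leg f hf p _ fun v hv => D.mem_of_adj hne hv
    have := Finset.card_insert_le (D.rep (f (Sum.inr (Sum.inl p))))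
      (D.side (f (Sum.inr (Sum.inl p))))
    rw [D.card_side] at this
    omega
  let a : Fin m := ⟨0, by omega⟩
  let b : Fin m := ⟨1, by omega⟩
  have hadj : ∀ i, D.graph.Adj (f (Sum.inl ())) (f (Sum.inr (Sum.inl (i, a)))) := fun i =>
    f.map_adj (vgs_adj_center rfl)
  have hc : D.syn (f (Sum.inl ())) = 0 := by
    by_contra hne
    obtain ⟨i, hi, j, hj, hij, hri, hrj⟩ := hpair
    have h1 := D.eq_rep_of_adj hne (hsyn (⟨i, hi⟩, a) hri) (hadj _)
    have h2 := D.eq_rep_of_adj hne (hsyn (⟨j, hj⟩, a) hrj) (hadj _)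
    have := hf (h1.trans h2.symm)
    simp at this
    exact hij this
  have hfirst : ∀ i, D.syn (f (Sum.inr (Sum.inl (i, a)))) = 0 := by
    intro i
    rcases le_max_iff.1 (hr_le i i.2) with h | h
    · exact hsyn (i, a) h
    · by_contra hne
      have h1 := D.eq_rep_of_adj hne hc (hadj i).symm
      have h2 := D.eq_rep_of_adj hne (hsyn (i, b) h)
        (f.map_adj (vgs_adj_leg (p := (i, a)) (q := (i, b)) rfl rfl))
      have := hf (h1.trans h2.symm)
      simp at this
  choose t ht using fun i => D.exists_τ_of_adj hc (hfirst i) (hadj i)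
  have : Function.Injective t := by
    intro i j hij
    have := hf ((ht i).trans ((by rw [hij]) : _ = _) |>.trans (ht j).symm)
    simpa using this
  have := Fintype.card_le_of_injective t this
  simp at this

/-- `L d i` (`i : Fin k`) are paths of length `m` in directions `τ` which start at `d` and
share no other vertex. -/
structure IsFan (m : ℕ) (L : (Fin n → Bool) → Fin k → ℕ → Fin n → Bool) : Prop where
  zero : ∀ d i, L d i 0 = d
  succ : ∀ d i, ∀ a < m, ∃ t, L d i (a + 1) = flipAt (D.τ t) (L d i a)
  apply_of_notMem : ∀ d i a x, x ∉ Set.range D.τ → L d i a x = d x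
  syn_eq : ∀ d i a, D.syn (L d i a) = D.syn d
  inj : ∀ d i i' a a', a ≤ m → a' ≤ m → L d i a = L d i' a' → a = a' ∧ (i = i' ∨ a = 0)

lemma exists_isFan {m : ℕ} (hm : 0 < m) (hfan : m ≤ Pfan k k) : ∃ L, D.IsFan m L := by
  obtain ⟨v, g, hg0, hg1, hg2⟩ := exists_fan_of_le_Pfan hm hfan
  let L : (Fin n → Bool) → Fin k → ℕ → Fin n → Bool := fun d i a x =>
    xor (d x) (Function.extend D.τ (fun t => xor (v t) (g i a t)) (fun _ => false) x)
  have hLτ : ∀ d i a t, L d i a (D.τ t) = xor (d (D.τ t)) (xor (v t) (g i a t)) := by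
    intro d i a t
    simp only [L]
    rw [D.τ_inj.extend_apply]
  have hLo : ∀ d i a x, x ∉ Set.range D.τ → L d i a x = d x := by
    intro d i a x hx
    simp only [L]
    rw [Function.extend_apply' _ _ _ hx, Bool.xor_false]
  refine ⟨L, fun d i => ?_, fun d i a ha => ?_, hLo, fun d i a => ?_,
    fun d i i' a a' ha ha' h => ?_⟩
  · funext x
    by_cases hx : x ∈ Set.range D.τ
    · obtain ⟨t, rfl⟩ := hx
      simp [hLτ, hg0]
    · exact hLo d i 0 x hx
  · obtain ⟨t, ht⟩ := hg1 i a ha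
    refine ⟨t, funext fun x => ?_⟩
    by_cases hx : x ∈ Set.range D.τ
    · obtain ⟨t', rfl⟩ := hx
      by_cases htt : t' = t
      · subst htt
        rw [flipAt_same, hLτ, hLτ, ht, flipAt_same]
        simp
      · rw [flipAt_of_ne (D.τ_inj.ne htt), hLτ, hLτ, ht, flipAt_of_ne htt]
    · rw [flipAt_of_ne (fun h => hx ⟨t, h.symm⟩), hLo _ _ _ _ hx, hLo _ _ _ _ hx]
  · unfold CubeLabelling.syn weightedSum
    refine Finset.sum_congr rfl fun x _ => ?_
    by_cases hx : x ∈ Set.range D.τ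
    · obtain ⟨t, rfl⟩ := hx
      simp [D.γ_τ]
    · rw [hLo _ _ _ _ hx]
  · refine hg2 i i' a a' ha ha' (funext fun t => ?_)
    have := congrFun h (D.τ t)
    simpa [hLτ] using this

end CubeLabelling

namespace CubeLabelling

variable {n k s : ℕ} {G : Type} [AddCommGroup G] (D : CubeLabelling n k s G)

lemma IsFan.adj {D : CubeLabelling n k s G} {m : ℕ}
    {L : (Fin n → Bool) → Fin k → ℕ → Fin n → Bool} (hL : D.IsFan m L) {d : Fin n → Bool}
    (hd : D.syn d = 0) (i : Fin k) {a : ℕ} (ha : a < m) :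
    D.graph.Adj (L d i a) (L d i (a + 1)) :=
  Or.inl ⟨by rw [hL.syn_eq, hd], hL.succ d i a ha⟩

/-- `z` does not lie in the subcube with directions `τ` through the vertex `d` of
syndrome `0`. -/
def Far (d z : Fin n → Bool) : Prop := D.syn z ≠ 0 ∨ ∃ a, a ∉ Set.range D.τ ∧ z a ≠ d a

variable {D} in
lemma Far.ne_fan {m : ℕ} {L : (Fin n → Bool) → Fin k → ℕ → Fin n → Bool} (hL : D.IsFan m L)
    {d z : Fin n → Bool} (hd : D.syn d = 0) (h : D.Far d z) (i : Fin k) (a : ℕ) :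
    z ≠ L d i a := by
  rintro rfl
  rcases h with h | ⟨x, hx, h⟩
  · exact h (by rw [hL.syn_eq, hd])
  · exact h (hL.apply_of_notMem d i a x hx)

variable {D} in
lemma Far.ne {d z : Fin n → Bool} (hd : D.syn d = 0) (h : D.Far d z) : z ≠ d := by
  rintro rfl
  rcases h with h | ⟨x, hx, h⟩
  · exact h hd
  · exact h rfl

variable {D} in
lemma Far.fan {m : ℕ} {L : (Fin n → Bool) → Fin k → ℕ → Fin n → Bool} (hL : D.IsFan m L)
    {d d' : Fin n → Bool} (h : ∃ a, a ∉ Set.range D.τ ∧ d' a ≠ d a) (i : Fin k) (a : ℕ) :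
    D.Far d (L d' i a) := by
  obtain ⟨x, hx, h⟩ := h
  exact Or.inr ⟨x, hx, by rwa [hL.apply_of_notMem d' i a x hx]⟩

open Classical in
/-- The vertices of nonzero syndrome assigned to `d`. -/
noncomputable def fibre (d : Fin n → Bool) : Finset (Fin n → Bool) :=
  Finset.univ.filter fun x => D.syn x ≠ 0 ∧ D.rep x = d

lemma mem_fibre {d x : Fin n → Bool} : x ∈ D.fibre d ↔ D.syn x ≠ 0 ∧ D.rep x = d := by
  simp [fibre]

lemma card_le_card_fibre [Fintype G] {d : Fin n → Bool} (hd : D.syn d = 0) :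
    Fintype.card G ≤ (D.fibre d).card + 1 := by
  classical
  have hinj : Function.Injective fun g => flipAt (D.κ g (parity d + 1)) d := by
    intro g g' h
    have := congrArg D.γ (flipAt_left_injective d h)
    rwa [D.γ_κ, D.γ_κ] at this
  have hsub : ((Finset.univ.erase (0 : G)).image fun g => flipAt (D.κ g (parity d + 1)) d) ⊆
      D.fibre d := by
    intro x hx
    obtain ⟨g, hg, rfl⟩ := Finset.mem_image.1 hx
    have hsyn : D.syn (flipAt (D.κ g (parity d + 1)) d) = g := by
      rw [syn_flipAt, D.γ_κ, hd, zero_add]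
    rw [mem_fibre, hsyn, rep, hsyn, parity_flipAt, flipAt_flipAt]
    exact ⟨Finset.ne_of_mem_erase hg, rfl⟩
  have := Finset.card_le_card hsub
  rw [Finset.card_image_of_injective _ hinj, Finset.card_erase_of_mem (Finset.mem_univ _),
    Finset.card_univ] at this
  omega

lemma hasCopy_of_path [Fintype G] {m : ℕ} {kk : ℕ → ℕ → ℕ} (hk : 0 < k)
    {L : (Fin n → Bool) → Fin k → ℕ → Fin n → Bool} (hL : D.IsFan m L)
    {H : SimpleGraph (Fin n → Bool)} (hH : D.graph ≤ H) {d : Fin n → Bool} (hd : D.syn d = 0)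
    (i₀ : Fin (k + 1)) (q : ℕ → Fin n → Bool) (M : ℕ → Finset (Fin n → Bool))
    (B : Finset (Fin n → Bool)) (hq_first : H.Adj d (q 0))
    (hq_next : ∀ j, j + 1 < m → H.Adj (q j) (q (j + 1)))
    (hq_inj : ∀ j < m, ∀ j' < m, q j = q j' → j = j') (hq_far : ∀ j < m, D.Far d (q j))
    (hB : ∀ j < m, D.syn (q j) ≠ 0 → q j ∈ B ∧ M j ⊆ B)
    (hM_card : ∀ j < m, D.syn (q j) ≠ 0 → kk i₀ j - legExtra m j ≤ (M j).card)
    (hM : ∀ j < m, D.syn (q j) ≠ 0 →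
      ∀ z ∈ M j, H.Adj (q j) z ∧ D.Far d z ∧ ∀ j' < m, z ≠ q j')
    (hM_disj : ∀ j < m, ∀ j' < m, j ≠ j' → D.syn (q j) ≠ 0 → D.syn (q j') ≠ 0 →
      Disjoint (M j) (M j'))
    (hcard : ∀ i < k + 1, ∀ j < m, kk i j + B.card + 1 ≤ Fintype.card G) :
    HasCopy H (vgs (k + 1) m kk) := by
  classical
  obtain ⟨θ, hθ⟩ : ∃ θ : Fin (k + 1) → Fin k,
      ∀ i i', i ≠ i₀ → i' ≠ i₀ → θ i = θ i' → i = i' := by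
    have : ∀ i, ∃ x : Fin k, i ≠ i₀ → i₀.succAbove x = i := by
      intro i
      by_cases h : i = i₀
      · exact ⟨⟨0, hk⟩, fun h' => absurd h h'⟩
      · obtain ⟨x, hx⟩ := Fin.exists_succAbove_eq h
        exact ⟨x, fun _ => hx⟩
    choose θ hθ using this
    exact ⟨θ, fun i i' hi hi' h => by rw [← hθ i hi, ← hθ i' hi', h]⟩
  let w : Fin (k + 1) × Fin m → Fin n → Bool := fun p =>
    if p.1 = i₀ then q p.2 else L d (θ p.1) (p.2 + 1)
  have hw_pos : ∀ {p : Fin (k + 1) × Fin m}, p.1 = i₀ → w p = q p.2 := fun h => if_pos h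
  have hw_neg : ∀ {p : Fin (k + 1) × Fin m}, p.1 ≠ i₀ → w p = L d (θ p.1) (p.2 + 1) :=
    fun h => if_neg h
  have hsmall : ∀ {p : Fin (k + 1) × Fin m}, D.syn (w p) ≠ 0 → p.1 = i₀ := by
    intro p h
    by_contra hp
    rw [hw_neg hp, hL.syn_eq, hd] at h
    exact h rfl
  have hw : Function.Injective w := by
    intro p p' h
    by_cases hp : p.1 = i₀ <;> by_cases hp' : p'.1 = i₀
    · rw [hw_pos hp, hw_pos hp'] at h
      exact Prod.ext (hp.trans hp'.symm) (Fin.ext (hq_inj _ p.2.2 _ p'.2.2 h))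
    · rw [hw_pos hp, hw_neg hp'] at h
      exact absurd h ((hq_far _ p.2.2).ne_fan hL hd _ _)
    · rw [hw_neg hp, hw_pos hp'] at h
      exact absurd h.symm ((hq_far _ p'.2.2).ne_fan hL hd _ _)
    · rw [hw_neg hp, hw_neg hp'] at h
      obtain ⟨h1, h2⟩ := hL.inj _ _ _ _ _ p.2.2 p'.2.2 h
      rcases h2 with h2 | h2
      · exact Prod.ext (hθ _ _ hp hp' h2) (Fin.ext (by omega))
      · omega
  have hwd : ∀ p, w p ≠ d := by
    intro p h
    by_cases hp : p.1 = i₀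
    · rw [hw_pos hp] at h
      exact (hq_far _ p.2.2).ne hd h
    · rw [hw_neg hp] at h
      have := (hL.inj _ _ _ _ _ p.2.2 (Nat.zero_le _) (h.trans (hL.zero d (θ p.1)).symm)).1
      omega
  refine hasCopy_vgs d w (fun p => if D.syn (w p) = 0 then D.fibre (w p) \ B else M p.2) hw hwd
    ?_ ?_ ?_ ?_ ?_
  · intro p hp0
    by_cases hp : p.1 = i₀
    · rw [hw_pos hp, hp0]
      exact hq_first
    · rw [hw_neg hp, hp0]
      have := hL.adj hd (θ p.1) (a := 0) (by have := p.2.2; omega)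
      rw [hL.zero] at this
      exact hH this
  · intro p p' hpp hpp'
    by_cases hp : p.1 = i₀
    · rw [hw_pos hp, hw_pos (hpp ▸ hp), ← hpp']
      exact hq_next _ (hpp' ▸ p'.2.2)
    · rw [hw_neg hp, hw_neg (hpp ▸ hp), ← hpp', ← hpp]
      exact hH (hL.adj hd _ (hpp' ▸ p'.2.2))
  · intro p z hz
    split_ifs at hz with hp
    · rw [Finset.mem_sdiff, mem_fibre] at hz
      obtain ⟨⟨hz0, hz⟩, hzB⟩ := hz
      refine ⟨hH ?_, fun h => hz0 (h ▸ hd), fun p' h => hzB ?_⟩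
      · rw [← hz]
        exact (D.graph_adj_rep hz0).symm
      · subst h
        have := hw_pos (hsmall hz0)
        rw [this] at hz0 ⊢
        exact (hB _ p'.2.2 hz0).1
    · have hp1 := hsmall hp
      rw [hw_pos hp1] at hp ⊢
      obtain ⟨h1, h2, h3⟩ := hM _ p.2.2 hp z hz
      refine ⟨h1, h2.ne hd, fun p' => ?_⟩
      by_cases hp' : p'.1 = i₀
      · rw [hw_pos hp']
        exact h3 _ p'.2.2
      · rw [hw_neg hp']
        exact h2.ne_fan hL hd _ _
  · intro p p' hpp
    rw [Finset.disjoint_left]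
    intro z hz hz'
    split_ifs at hz hz' with hp hp' hp'
    · rw [Finset.mem_sdiff, mem_fibre] at hz hz'
      exact hpp (hw (hz.1.2.symm.trans hz'.1.2))
    · rw [hw_pos (hsmall hp')] at hp'
      exact (Finset.mem_sdiff.1 hz).2 ((hB _ p'.2.2 hp').2 hz')
    · rw [hw_pos (hsmall hp)] at hp
      exact (Finset.mem_sdiff.1 hz').2 ((hB _ p.2.2 hp).2 hz)
    · have h1 := hsmall hp
      have h2 := hsmall hp'
      rw [hw_pos h1] at hp
      rw [hw_pos h2] at hp'
      refine Finset.disjoint_left.1 (hM_disj _ p.2.2 _ p'.2.2 (fun h => hpp ?_) hp hp') hz hz'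
      exact Prod.ext (h1.trans h2.symm) (Fin.ext h)
  · intro p
    split_ifs with hp
    · have h1 := D.card_le_card_fibre hp
      have h2 := Finset.le_card_sdiff B (D.fibre (w p))
      have h3 := hcard p.1 p.1.2 p.2 p.2.2
      omega
    · have h1 := hsmall hp
      rw [hw_pos h1] at hp
      rw [h1]
      exact hM_card _ p.2.2 hp

section Saturation

variable [Fintype G] {m r : ℕ} {kk : ℕ → ℕ → ℕ}
  {L : (Fin n → Bool) → Fin k → ℕ → Fin n → Bool} {H : SimpleGraph (Fin n → Bool)}

lemma hasCopy_of_adj_zero_zero (hk : 0 < k) (hL : D.IsFan m L) (hH : D.graph ≤ H)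
    (hcard : ∀ i < k + 1, ∀ j < m, kk i j + 2 * r + 1 ≤ Fintype.card G) {d d' : Fin n → Bool}
    (hd : D.syn d = 0) (hd' : D.syn d' = 0) (hQ : (hypercube n).Adj d d')
    (hadj : ¬ D.graph.Adj d d') (hHadj : H.Adj d d') :
    HasCopy H (vgs (k + 1) m kk) := by
  obtain ⟨i, rfl⟩ := hypercube_adj.1 hQ
  have hi : i ∉ Set.range D.τ := by
    rintro ⟨j, rfl⟩
    exact hadj (Or.inl ⟨hd, j, rfl⟩)
  have hsyn : ∀ j, D.syn (L (flipAt i d) ⟨0, hk⟩ j) = 0 := fun j => by rw [hL.syn_eq, hd']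
  refine D.hasCopy_of_path hk hL hH hd 0 (fun j => L (flipAt i d) ⟨0, hk⟩ j) (fun _ => ∅) ∅
    ?_ ?_ ?_ ?_ ?_ ?_ ?_ ?_ ?_
  · simpa [hL.zero] using hHadj
  · exact fun j hj => hH (hL.adj hd' _ (by omega))
  · exact fun j hj j' hj' h => (hL.inj _ _ _ _ _ hj.le hj'.le h).1
  · exact fun j hj => Far.fan hL ⟨i, hi, by simp⟩ _ _
  · exact fun j _ h => absurd (hsyn j) h
  · exact fun j _ h => absurd (hsyn j) h
  · exact fun j _ h => absurd (hsyn j) h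
  · exact fun j _ _ _ _ h => absurd (hsyn j) h
  · intro i hi j hj
    have := hcard i hi j hj
    simp only [Finset.card_empty]
    omega

lemma hasCopy_of_adj_zero_nonzero (hk : 0 < k) (hm : 2 ≤ m) (hL : D.IsFan m L)
    (hH : D.graph ≤ H) (hs : s + 2 = r) {i₀ : Fin (k + 1)} (hi₀ : max (kk i₀ 0) (kk i₀ 1) = r)
    (hcard : ∀ i < k + 1, ∀ j < m, kk i j + 2 * r + 1 ≤ Fintype.card G) {d x : Fin n → Bool}
    (hd : D.syn d = 0) (hx : D.syn x ≠ 0) (hQ : (hypercube n).Adj d x)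
    (hadj : ¬ D.graph.Adj d x) (hHadj : H.Adj d x) :
    HasCopy H (vgs (k + 1) m kk) := by
  classical
  obtain ⟨i, hi⟩ := hypercube_adj.1 hQ
  set a := D.κ (D.syn x) (parity x) with ha
  have hai : a ≠ i := by
    intro h
    refine hadj (Or.inr (Or.inr (Or.inr ⟨hx, ?_⟩)))
    rw [rep, ← ha, h]
    exact eq_flipAt_comm hi
  have haτ : a ∉ Set.range D.τ := by
    rintro ⟨j, hj⟩
    exact D.κ_ne_τ _ _ j hj.symm
  have hfar : ∃ a, a ∉ Set.range D.τ ∧ D.rep x a ≠ d a := by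
    refine ⟨a, haτ, ?_⟩
    rw [rep, ← ha, flipAt_same, hi, flipAt_of_ne hai]
    simp
  let q : ℕ → Fin n → Bool := fun j => Nat.casesOn j x fun j => L (D.rep x) ⟨0, hk⟩ j
  have hsyn : ∀ j, D.syn (q (j + 1)) = 0 := fun j => (hL.syn_eq _ _ _).trans (D.syn_rep x)
  have hside : ∀ z ∈ D.side x, D.syn z ≠ 0 := fun z hz => by rwa [D.syn_of_mem_side hz]
  refine D.hasCopy_of_path hk hL hH hd i₀ q (fun _ => D.side x) (insert x (D.side x))
    hHadj ?_ ?_ ?_ ?_ ?_ ?_ ?_ ?_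
  · rintro (_ | j) hj
    · change H.Adj x (L (D.rep x) _ 0)
      rw [hL.zero]
      exact hH (D.graph_adj_rep hx)
    · exact hH (hL.adj (D.syn_rep x) _ (by omega))
  · rintro (_ | j) hj (_ | j') hj' h
    · rfl
    · exact absurd ((congrArg D.syn h).trans (hsyn j')) hx
    · exact absurd ((congrArg D.syn h).symm.trans (hsyn j)) hx
    · rw [(hL.inj _ _ _ _ _ (by omega) (by omega) h).1]
  · rintro (_ | j) hj
    · exact Or.inl hx
    · exact Far.fan hL hfar _ _
  · rintro (_ | j) hj h
    · exact ⟨Finset.mem_insert_self _ _, Finset.subset_insert _ _⟩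
    · exact absurd (hsyn j) h
  · rintro (_ | j) hj h
    · rw [D.card_side, legExtra, if_neg (by omega)]
      have := le_max_left (kk i₀ 0) (kk i₀ 1)
      omega
    · exact absurd (hsyn j) h
  · rintro (_ | j) hj h z hz
    · refine ⟨hH (D.graph_adj_of_mem_side hx hz), Or.inl (hside z hz), ?_⟩
      rintro (_ | j') hj' rfl
      · exact (D.graph_adj_of_mem_side hx hz).ne rfl
      · exact hside _ hz (hsyn j')
    · exact absurd (hsyn j) h
  · rintro (_ | j) hj (_ | j') hj' hne h h'
    · exact absurd rfl hne
    · exact absurd (hsyn j') h'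
    · exact absurd (hsyn j) h
    · exact absurd (hsyn j) h
  · intro i hi j hj
    have h1 := hcard i hi j hj
    have h2 := Finset.card_insert_le x (D.side x)
    rw [D.card_side] at h2
    omega

lemma hasCopy_of_adj_nonzero_nonzero (hk : 0 < k) (hm : 2 ≤ m) (hL : D.IsFan m L)
    (hH : D.graph ≤ H) (hs : s + 2 = r) {i₀ : Fin (k + 1)} (hi₀ : max (kk i₀ 0) (kk i₀ 1) = r)
    (hcard : ∀ i < k + 1, ∀ j < m, kk i j + 2 * r + 1 ≤ Fintype.card G) {x y : Fin n → Bool}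
    (hx : D.syn x ≠ 0) (hy : D.syn y ≠ 0) (hQ : (hypercube n).Adj x y)
    (hadj : ¬ D.graph.Adj x y) (hHadj : H.Adj x y) :
    HasCopy H (vgs (k + 1) m kk) := by
  classical
  obtain ⟨i, hi⟩ := hypercube_adj.1 hQ
  have hpar : parity y = parity x + 1 := by rw [hi, parity_flipAt]
  have hκτ : ∀ g b, D.κ g b ∉ Set.range D.τ := by
    rintro g b ⟨j, hj⟩
    exact D.κ_ne_τ _ _ j hj.symm
  have hfar : ∃ a, a ∉ Set.range D.τ ∧ D.rep y a ≠ D.rep x a := by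
    set a := D.κ (D.syn x) (parity x) with ha
    set b := D.κ (D.syn y) (parity y) with hb
    have hab : a ≠ b := by
      intro h
      have := D.κ_inj h
      rw [hpar] at this
      simp at this
    by_cases hia : a = i
    · refine ⟨b, hκτ _ _, ?_⟩
      rw [rep, rep, ← ha, ← hb, flipAt_same, flipAt_of_ne hab.symm, hi,
        flipAt_of_ne (hia ▸ hab.symm)]
      simp
    · refine ⟨a, hκτ _ _, ?_⟩
      rw [rep, rep, ← ha, ← hb, flipAt_same, flipAt_of_ne hab, hi, flipAt_of_ne hia]
      simp
  have hyx : y ∉ D.side x := fun h => hadj (D.graph_adj_of_mem_side hx h)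
  have hxy : x ∉ D.side y := fun h => hadj (D.graph_adj_of_mem_side hy h).symm
  have hdisj : Disjoint (D.side x) (D.side y) := by
    rw [Finset.disjoint_left]
    intro z hz hz'
    have := (D.parity_of_mem_side hz).symm.trans (D.parity_of_mem_side hz')
    rw [hpar] at this
    simp at this
  have hsx : ∀ z ∈ D.side x, D.syn z ≠ 0 := fun z hz => by rwa [D.syn_of_mem_side hz]
  have hsy : ∀ z ∈ D.side y, D.syn z ≠ 0 := fun z hz => by rwa [D.syn_of_mem_side hz]
  let q : ℕ → Fin n → Bool := fun j =>
    Nat.casesOn j x fun j => Nat.casesOn j y fun j => L (D.rep y) ⟨0, hk⟩ j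
  let My : Finset (Fin n → Bool) := if m = 2 then insert (D.rep y) (D.side y) else D.side y
  have hMy : ∀ z ∈ My, z = D.rep y ∧ m = 2 ∨ z ∈ D.side y := by
    intro z hz
    simp only [My] at hz
    split_ifs at hz with h2
    · exact (Finset.mem_insert.1 hz).imp_left fun h => ⟨h, h2⟩
    · exact Or.inr hz
  have hrep : D.rep y ∉ D.side x := fun h => hsx _ h (D.syn_rep y)
  have hrep' : D.rep y ∉ D.side y := fun h => hsy _ h (D.syn_rep y)
  have hdisj' : Disjoint (D.side x) My := by
    rw [Finset.disjoint_left]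
    intro z hz hz'
    rcases hMy z hz' with ⟨rfl, -⟩ | hz'
    · exact hrep hz
    · exact Finset.disjoint_left.1 hdisj hz hz'
  have hMy_card : kk i₀ 1 - legExtra m 1 ≤ My.card := by
    have := le_max_right (kk i₀ 0) (kk i₀ 1)
    simp only [My]
    rw [legExtra]
    split_ifs with h1 h2 h2
    · rw [Finset.card_insert_of_notMem hrep', D.card_side]
      omega
    · omega
    · omega
    · rw [D.card_side]
      omega
  have hMy_card' : My.card ≤ s + 1 := by
    simp only [My]
    split_ifs
    · rw [Finset.card_insert_of_notMem hrep', D.card_side]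
    · rw [D.card_side]
      omega
  have hsyn : ∀ j, D.syn (q (j + 2)) = 0 := fun j => (hL.syn_eq _ _ _).trans (D.syn_rep y)
  refine D.hasCopy_of_path hk hL hH (D.syn_rep x) i₀ q
    (fun j => Nat.casesOn j (D.side x) fun _ => My) ({x, y} ∪ (D.side x ∪ My))
    ?_ ?_ ?_ ?_ ?_ ?_ ?_ ?_ ?_
  · exact hH (D.graph_adj_rep hx).symm
  · rintro (_ | _ | j) hj
    · exact hHadj
    · change H.Adj y (L (D.rep y) _ 0)
      rw [hL.zero]
      exact hH (D.graph_adj_rep hy)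
    · exact hH (hL.adj (D.syn_rep y) _ (by omega))
  · rintro (_ | _ | j) hj (_ | _ | j') hj' h
    · rfl
    · exact absurd h hHadj.ne
    · exact absurd ((congrArg D.syn h).trans (hsyn j')) hx
    · exact absurd h hHadj.ne'
    · rfl
    · exact absurd ((congrArg D.syn h).trans (hsyn j')) hy
    · exact absurd ((congrArg D.syn h).symm.trans (hsyn j)) hx
    · exact absurd ((congrArg D.syn h).symm.trans (hsyn j)) hy
    · rw [(hL.inj _ _ _ _ _ (by omega) (by omega) h).1]
  · rintro (_ | _ | j) hj
    · exact Or.inl hx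
    · exact Or.inl hy
    · exact Far.fan hL hfar _ _
  · rintro (_ | _ | j) hj h
    · exact ⟨by simp [q], fun z hz => by simp [show z ∈ D.side x from hz]⟩
    · exact ⟨by simp [q], fun z hz => by simp [show z ∈ My from hz]⟩
    · exact absurd (hsyn j) h
  · rintro (_ | _ | j) hj h
    · change _ ≤ (D.side x).card
      rw [D.card_side, legExtra, if_neg (by omega)]
      have := le_max_left (kk i₀ 0) (kk i₀ 1)
      omega
    · exact hMy_card
    · exact absurd (hsyn j) h
  · rintro (_ | _ | j) hj h z hz
    · change z ∈ D.side x at hz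
      have hxz := D.graph_adj_of_mem_side hx hz
      refine ⟨hH hxz, Or.inl (hsx z hz), ?_⟩
      rintro (_ | _ | j') hj' rfl
      · exact hxz.ne rfl
      · exact hyx hz
      · exact hsx _ hz (hsyn j')
    · rcases hMy z hz with ⟨rfl, rfl⟩ | hz
      · refine ⟨hH (D.graph_adj_rep hy), Or.inr hfar, ?_⟩
        rintro (_ | _ | j') hj' h'
        · exact hx ((congrArg D.syn h').symm.trans (D.syn_rep y))
        · exact (D.graph_adj_rep hy).ne' h'
        · omega
      · have hyz := D.graph_adj_of_mem_side hy hz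
        refine ⟨hH hyz, Or.inl (hsy z hz), ?_⟩
        rintro (_ | _ | j') hj' h'
        · have h' : z = x := h'
          exact hxy (h' ▸ hz)
        · exact hyz.ne' h'
        · exact hsy _ hz (h' ▸ hsyn j')
    · exact absurd (hsyn j) h
  · rintro (_ | _ | j) hj (_ | _ | j') hj' hne h h'
    · exact absurd rfl hne
    · exact hdisj'
    · exact absurd (hsyn j') h'
    · exact hdisj'.symm
    · exact absurd rfl hne
    · exact absurd (hsyn j') h'
    · exact absurd (hsyn j) h
    · exact absurd (hsyn j) h
    · exact absurd (hsyn j) h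
  · intro i hi j hj
    have h1 := hcard i hi j hj
    have h2 := Finset.card_union_le {x, y} (D.side x ∪ My)
    have h3 := Finset.card_union_le (D.side x) My
    have h4 : ({x, y} : Finset (Fin n → Bool)).card ≤ 2 := Finset.card_le_two
    rw [D.card_side] at h3
    omega

lemma isSat_graph (hk : 0 < k) (hm : 2 ≤ m) (hfan : m ≤ Pfan k k) (hs : s + 2 = r)
    (hr_le : ∀ i < k + 1, r ≤ max (kk i 0) (kk i 1))
    (hr_ex : ∃ i < k + 1, max (kk i 0) (kk i 1) = r)
    (hpair : ∃ i < k + 1, ∃ j < k + 1, i ≠ j ∧ r ≤ kk i 0 ∧ r ≤ kk j 0)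
    (hcard : ∀ i < k + 1, ∀ j < m, kk i j + 2 * r + 1 ≤ Fintype.card G) :
    IsSat (hypercube n) D.graph (vgs (k + 1) m kk) := by
  refine ⟨D.graph_le, D.not_hasCopy_graph hm hs.le hr_le hpair, fun u v hQ hadj => ?_⟩
  obtain ⟨L, hL⟩ := D.exists_isFan (by omega : 0 < m) hfan
  obtain ⟨i, hi, hir⟩ := hr_ex
  have hH : D.graph ≤ D.graph ⊔ SimpleGraph.fromEdgeSet {s(u, v)} := le_sup_left
  have hHadj : (D.graph ⊔ SimpleGraph.fromEdgeSet {s(u, v)}).Adj u v :=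
    Or.inr ((SimpleGraph.fromEdgeSet_adj _).2 ⟨rfl, hQ.ne⟩)
  by_cases hu : D.syn u = 0 <;> by_cases hv : D.syn v = 0
  · exact D.hasCopy_of_adj_zero_zero hk hL hH hcard hu hv hQ hadj hHadj
  · exact D.hasCopy_of_adj_zero_nonzero (i₀ := ⟨i, hi⟩) hk hm hL hH hs hir hcard hu hv hQ hadj
      hHadj
  · exact D.hasCopy_of_adj_zero_nonzero (i₀ := ⟨i, hi⟩) hk hm hL hH hs hir hcard hv hu hQ.symm
      (fun h => hadj h.symm) hHadj.symm
  · exact D.hasCopy_of_adj_nonzero_nonzero (i₀ := ⟨i, hi⟩) hk hm hL hH hs hir hcard hu hv hQ hadj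
      hHadj

end Saturation

end CubeLabelling

/-- upper bound on `sat(Q_n, VGS_{k,m})`, where
`r = min_i max(k_{i1}, k_{i2})` (in 0-based terms `max (kk i 0) (kk i 1)`),
there are two distinct legs with first-vertex degree at least `r`,
`m ≤ P_{k-1}(Q_{k-1})`, and `r ≥ k`. -/
theorem stmt8 (k m : ℕ) (hk : 2 ≤ k) (hm : 2 ≤ m) (kk : ℕ → ℕ → ℕ) (r : ℕ)
    (hr_le : ∀ i < k, r ≤ max (kk i 0) (kk i 1))
    (hr_ex : ∃ i < k, max (kk i 0) (kk i 1) = r)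
    (hpair : ∃ i < k, ∃ j < k, i ≠ j ∧ r ≤ kk i 0 ∧ r ≤ kk j 0)
    (hfan : m ≤ Pfan (k - 1) (k - 1)) (hrk : k ≤ r) :
    ∃ N : ℕ, ∀ n ≥ N, satNum (hypercube n) (vgs k m kk) ≤ r * 2 ^ (n - 1) := by
  obtain ⟨k, rfl⟩ : ∃ k', k = k' + 1 := ⟨k - 1, by omega⟩
  obtain ⟨s, hs⟩ : ∃ s, s + 2 = r := ⟨r - 2, by omega⟩
  rw [Nat.add_sub_cancel] at hfan
  let K := ∑ i ∈ Finset.range (k + 1), ∑ j ∈ Finset.range m, kk i j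
  have hK : ∀ i < k + 1, ∀ j < m, kk i j ≤ K := fun i hi j hj =>
    (Finset.single_le_sum (f := fun j => kk i j) (fun _ _ => Nat.zero_le _)
      (Finset.mem_range.2 hj)).trans
    (Finset.single_le_sum (f := fun i => ∑ j ∈ Finset.range m, kk i j) (fun _ _ => Nat.zero_le _)
      (Finset.mem_range.2 hi))
  let t := K + 2 * r
  refine ⟨2 ^ t * 2 + (k + s), fun n hn => ?_⟩
  obtain ⟨D⟩ := exists_cubeLabelling t k s n hn
  have hcard : ∀ i < k + 1, ∀ j < m, kk i j + 2 * r + 1 ≤ Fintype.card (Fin t → ZMod 2) := by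
    intro i hi j hj
    have h1 := hK i hi j hj
    have h2 : t < 2 ^ t := Nat.lt_two_pow_self
    simp only [Fintype.card_pi, ZMod.card, Finset.prod_const, Finset.card_univ, Fintype.card_fin]
    omega
  have hsat := D.isSat_graph (by omega) hm hfan hs hr_le hr_ex hpair hcard
  have hle : satNum (hypercube n) (vgs (k + 1) m kk) ≤ D.graph.edgeSet.ncard :=
    Nat.sInf_le ⟨D.graph, hsat, rfl⟩
  refine hle.trans ?_
  have h1 := D.two_mul_ncard_edgeSet_le (r := r) (by omega) hs.le
  have h2 : 0 < 2 ^ t := by positivity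
  obtain ⟨n, rfl⟩ : ∃ n', n = n' + 1 := ⟨n - 1, by omega⟩
  rw [pow_succ, ← mul_assoc] at h1
  rw [Nat.add_sub_cancel]
  omega
end

section
/- For every integer k ≥ 2 and every n ≥ ⌊log_2 k⌋ + 1, sat(Q_n, P_k) ≤ ⌊log_2 k⌋ · 2^(n−1). -/
open SimpleGraph

/-- The vertex obtained from `u` by flipping coordinate `i`. -/
def flipCoord {n : ℕ} (u : Fin n → Bool) (i : Fin n) : Fin n → Bool :=
  Function.update u i (!u i)

@[simp]
theorem flipCoord_self {n : ℕ} (u : Fin n → Bool) (i : Fin n) : flipCoord u i i = !u i := by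
  simp [flipCoord]

theorem flipCoord_of_ne {n : ℕ} (u : Fin n → Bool) {i j : Fin n} (h : j ≠ i) :
    flipCoord u i j = u j := by
  simp [flipCoord, h]

@[simp]
theorem flipCoord_flipCoord {n : ℕ} (u : Fin n → Bool) (i : Fin n) :
    flipCoord (flipCoord u i) i = u := by
  ext j
  by_cases h : j = i
  · subst h; simp
  · simp [flipCoord_of_ne, h]

theorem flipCoord_ne {n : ℕ} (u : Fin n → Bool) (i : Fin n) : flipCoord u i ≠ u := by
  intro h
  have := congrFun h i
  simp at this

theorem hammingDist_eq_one_iff {n : ℕ} (u v : Fin n → Bool) :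
    hammingDist u v = 1 ↔ ∃ i, v = flipCoord u i := by
  unfold hammingDist
  rw [Finset.card_eq_one]
  refine exists_congr fun i => ?_
  simp only [Finset.ext_iff, Finset.mem_filter, Finset.mem_univ, true_and, Finset.mem_singleton]
  constructor
  · intro h
    ext j
    by_cases hj : j = i
    · subst hj
      have := (h j).2 rfl
      simpa [Bool.eq_not] using this.symm
    · rw [flipCoord_of_ne u hj]
      have := (h j).not.2 hj
      simpa using (not_not.1 this).symm
  · rintro rfl j
    by_cases hj : j = i
    · subst hj; simp
    · simp [flipCoord_of_ne, hj]

theorem hypercube_adj_iff {n : ℕ} (u v : Fin n → Bool) :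
    (hypercube n).Adj u v ↔ ∃ i, v = flipCoord u i := by
  rw [hypercube, SimpleGraph.fromRel_adj, hammingDist_comm v u, or_self, hammingDist_eq_one_iff]
  constructor
  · exact fun h => h.2
  · rintro ⟨i, rfl⟩
    exact ⟨(flipCoord_ne u i).symm, i, rfl⟩

/-- The spanning subgraph of `Q_n` formed by the edges in the first `d` directions, a disjoint
union of copies of `Q_d`. -/
def subcubes (n d : ℕ) : SimpleGraph (Fin n → Bool) where
  Adj u v := ∃ i : Fin n, i.val < d ∧ v = flipCoord u i
  symm := ⟨by
    rintro u v ⟨i, hi, rfl⟩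
    exact ⟨i, hi, by simp⟩⟩
  loopless := ⟨fun u ⟨i, _, h⟩ => flipCoord_ne u i h.symm⟩

theorem subcubes_mono (n : ℕ) {d e : ℕ} (h : d ≤ e) : subcubes n d ≤ subcubes n e := by
  rintro u v ⟨i, hi, rfl⟩
  exact ⟨i, hi.trans_le h, rfl⟩

theorem subcubes_adj_apply {n d : ℕ} {u v : Fin n → Bool} (h : (subcubes n d).Adj u v)
    {j : Fin n} (hj : d ≤ j) : v j = u j := by
  obtain ⟨i, hi, rfl⟩ := h
  exact flipCoord_of_ne u (by rintro rfl; omega)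

/-- Every vertex is the start of a Hamiltonian path of its copy of `Q_d`. -/
theorem exists_hamiltonian_list (n d : ℕ) (hd : d ≤ n) (v : Fin n → Bool) :
    ∃ l : List (Fin n → Bool), (v :: l).Nodup ∧ (v :: l).IsChain (subcubes n d).Adj ∧
      (v :: l).length = 2 ^ d ∧ ∀ w ∈ v :: l, ∀ j : Fin n, d ≤ j → w j = v j := by
  induction d generalizing v with
  | zero => exact ⟨[], by simp⟩
  | succ d ih =>
    obtain ⟨l, hnd, hch, hlen, hag⟩ := ih (by omega) v
    let i : Fin n := ⟨d, hd⟩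
    let x := (v :: l).getLast (by simp)
    have hx : x ∈ v :: l := List.getLast_mem _
    obtain ⟨l', hnd', hch', hlen', hag'⟩ := ih (by omega) (flipCoord x i)
    refine ⟨l ++ flipCoord x i :: l', ?_, ?_, ?_, ?_⟩
    · rw [← List.cons_append, List.nodup_append]
      refine ⟨hnd, hnd', ?_⟩
      rintro a ha b hb rfl
      have h1 := hag a ha i le_rfl
      have h2 := hag' a hb i le_rfl
      have h3 := hag x hx i le_rfl
      rw [flipCoord_self, h3, h1] at h2
      simp at h2
    · rw [← List.cons_append, List.isChain_append]
      refine ⟨hch.imp fun _ _ h => subcubes_mono n d.le_succ h,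
        hch'.imp fun _ _ h => subcubes_mono n d.le_succ h, ?_⟩
      intro a ha b hb
      rw [List.getLast?_eq_some_getLast (by simp)] at ha
      simp only [Option.mem_def, Option.some.injEq, List.head?_cons] at ha hb
      subst ha hb
      exact ⟨i, d.lt_succ_self, rfl⟩
    · rw [← List.cons_append, List.length_append, hlen, hlen', pow_succ]
      omega
    · intro w hw j hj
      rw [← List.cons_append, List.mem_append] at hw
      rcases hw with hw | hw
      · exact hag w hw j (by omega)
      · rw [hag' w hw j (by omega), flipCoord_of_ne x (by rintro rfl; simp [i] at hj),
          hag x hx j (by omega)]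

theorem hasCopy_pathGraph_of_isChain {V : Type*} {G : SimpleGraph V} {l : List V}
    (hnd : l.Nodup) (hch : l.IsChain G.Adj) {k : ℕ} (hk : k ≤ l.length) :
    HasCopy G (SimpleGraph.pathGraph k) := by
  have hstep : ∀ a b : Fin k, a.val + 1 = b.val →
      G.Adj (l[a.val]'(by omega)) (l[b.val]'(by omega)) := by
    intro a b hab
    have := List.isChain_iff_getElem.1 hch a.val (by omega)
    simpa only [hab] using this
  refine ⟨⟨fun a => l[a.val]'(by omega), ?_⟩, ?_⟩
  · intro a b hab
    rw [SimpleGraph.pathGraph_adj] at hab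
    rcases hab with h | h
    · exact hstep a b h
    · exact (hstep b a h).symm
  · intro a b hab
    exact Fin.ext ((hnd.getElem_inj_iff).1 hab)

theorem not_hasCopy_subcubes {n d k : ℕ} (hd : d ≤ n) (hk : 2 ^ d ≤ k) :
    ¬ HasCopy (subcubes n d) (SimpleGraph.pathGraph (k + 1)) := by
  rintro ⟨f, hf⟩
  have hconst : ∀ (j : Fin n), d ≤ j → ∀ a : Fin (k + 1), f a j = f 0 j := by
    intro j hj a
    induction a using Fin.induction with
    | zero => rfl
    | succ a ih =>
      rw [← ih]
      exact subcubes_adj_apply (f.map_adj (by simp [SimpleGraph.pathGraph_adj])) hj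
  have hinj : Function.Injective
      fun (a : Fin (k + 1)) (j : Fin d) => f a (Fin.castLE hd j) := by
    intro a b hab
    apply hf
    ext j
    rcases lt_or_ge j.val d with hj | hj
    · exact congrFun hab ⟨j, hj⟩
    · rw [hconst j hj a, hconst j hj b]
  have := Fintype.card_le_of_injective _ hinj
  simp at this
  omega

theorem isSat_subcubes {n d k : ℕ} (hd : d ≤ n) (hk : 2 ^ d ≤ k) (hk' : k < 2 ^ (d + 1)) :
    IsSat (hypercube n) (subcubes n d) (SimpleGraph.pathGraph (k + 1)) := by
  refine ⟨?_, not_hasCopy_subcubes hd hk, ?_⟩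
  · rintro u v ⟨i, -, h⟩
    exact (hypercube_adj_iff u v).2 ⟨i, h⟩
  · intro u v huv hnot
    obtain ⟨i, rfl⟩ := (hypercube_adj_iff u v).1 huv
    have hi : d ≤ i := not_lt.1 fun h => hnot ⟨i, h, rfl⟩
    obtain ⟨l, hnd, hch, hlen, hag⟩ := exists_hamiltonian_list n d hd u
    obtain ⟨l', hnd', hch', hlen', hag'⟩ := exists_hamiltonian_list n d hd (flipCoord u i)
    refine hasCopy_pathGraph_of_isChain (l := (u :: l).reverse ++ flipCoord u i :: l') ?_ ?_ ?_
    · rw [List.nodup_append]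
      refine ⟨List.nodup_reverse.2 hnd, hnd', ?_⟩
      rintro a ha b hb rfl
      have h1 := hag a (List.mem_reverse.1 ha) i hi
      have h2 := hag' a hb i hi
      rw [h1, flipCoord_self] at h2
      simp at h2
    · rw [List.isChain_append]
      refine ⟨List.isChain_reverse.2 (hch.imp fun _ _ h => Or.inl h.symm),
        hch'.imp fun _ _ h => Or.inl h, ?_⟩
      intro a ha b hb
      simp only [List.getLast?_reverse, Option.mem_def, Option.some.injEq, List.head?_cons]
        at ha hb
      subst ha hb
      right
      simpa using (flipCoord_ne u i).symm
    · rw [List.length_append, List.length_reverse, hlen, hlen']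
      rw [pow_succ] at hk'
      omega

theorem ncard_edgeSet_subcubes_le (n d : ℕ) (hn : 1 ≤ n) :
    (subcubes n d).edgeSet.ncard ≤ d * 2 ^ (n - 1) := by
  classical
  have hdeg : ∀ u, (subcubes n d).degree u ≤ d := by
    intro u
    have hsub : (subcubes n d).neighborFinset u ⊆
        (Finset.univ.filter fun i : Fin n => i.val < d).image (flipCoord u) := by
      intro v hv
      rw [SimpleGraph.mem_neighborFinset] at hv
      obtain ⟨i, hi, rfl⟩ := hv
      exact Finset.mem_image_of_mem _ (by simpa using hi)
    refine (Finset.card_le_card hsub).trans (Finset.card_image_le.trans ?_)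
    rw [← Finset.card_range d]
    exact Finset.card_le_card_of_injOn Fin.val (by intro i; simp) Fin.val_injective.injOn
  have hsum := (subcubes n d).sum_degrees_eq_twice_card_edges
  have hle : ∑ u, (subcubes n d).degree u ≤ 2 ^ n * d := by
    simpa using Finset.sum_le_card_nsmul Finset.univ _ d fun u _ => hdeg u
  rw [← SimpleGraph.coe_edgeFinset, Set.ncard_coe_finset]
  obtain ⟨m, rfl⟩ := Nat.exists_eq_add_of_le' hn
  rw [hsum, pow_succ] at hle
  rw [Nat.add_sub_cancel]
  linarith

/-- `sat(Q_n, P_k) ≤ ⌊log₂ k⌋ · 2^(n-1)` for `k ≥ 2` and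
`n ≥ ⌊log₂ k⌋ + 1`, where `P_k` is the path with `k` edges (`k+1` vertices). -/
theorem stmt11 (k : ℕ) (hk : 2 ≤ k) (n : ℕ) (hn : Nat.log 2 k + 1 ≤ n) :
    satNum (hypercube n) (SimpleGraph.pathGraph (k + 1)) ≤ Nat.log 2 k * 2 ^ (n - 1) := by
  have hd : Nat.log 2 k ≤ n := by omega
  have hsat : IsSat (hypercube n) (subcubes n (Nat.log 2 k)) (SimpleGraph.pathGraph (k + 1)) :=
    isSat_subcubes hd (Nat.pow_log_le_self 2 (by omega)) (Nat.lt_pow_succ_log_self (by norm_num) k)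
  have hle : satNum (hypercube n) (SimpleGraph.pathGraph (k + 1)) ≤
      (subcubes n (Nat.log 2 k)).edgeSet.ncard :=
    Nat.sInf_le ⟨_, hsat, rfl⟩
  exact hle.trans (ncard_edgeSet_subcubes_le n _ (by omega))
end

section
/- Let k ≥ 2 be an integer and let 0 < j ≤ 2^(k−1). Then there exists a set C of exactly j even-weight vertices of Q_k such that the graph obtained from Q_k by deleting C contains a path of length 2^k − 2j. -/
open SimpleGraph

/-- The weight of a vertex of the hypercube: its number of `1` coordinates. -/
def wt {k : ℕ} (v : Fin k → Bool) : ℕ := (Finset.univ.filter (fun i => v i = true)).card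

theorem wt_cons {k : ℕ} (b : Bool) (v : Fin k → Bool) :
    wt (Fin.cons b v : Fin (k + 1) → Bool) = (if b then 1 else 0) + wt v := by
  simp only [wt, Finset.card_filter, Fin.sum_univ_succ, Fin.cons_zero, Fin.cons_succ]

theorem hammingDist_cons {k : ℕ} (a b : Bool) (u v : Fin k → Bool) :
    hammingDist (Fin.cons a u : Fin (k + 1) → Bool) (Fin.cons b v) =
      (if a ≠ b then 1 else 0) + hammingDist u v := by
  simp only [hammingDist, Finset.card_filter, Fin.sum_univ_succ, Fin.cons_zero, Fin.cons_succ]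

/-- The reflected Gray code: an enumeration of the hypercube in which consecutive vertices are
at Hamming distance one and weights have the parity of the index. -/
theorem exists_grayCode (k : ℕ) : ∃ f : ℕ → Fin k → Bool,
    (∀ i < 2 ^ k, ∀ i' < 2 ^ k, f i = f i' → i = i') ∧
    (∀ i, i + 1 < 2 ^ k → hammingDist (f i) (f (i + 1)) = 1) ∧
    (∀ i < 2 ^ k, wt (f i) % 2 = i % 2) := by
  induction k with
  | zero =>
    refine ⟨fun _ => Fin.elim0, fun i hi i' hi' _ => by omega, fun i hi => by omega, fun i hi => ?_⟩
    obtain rfl : i = 0 := by omega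
    simp [wt]
  | succ k ih =>
    obtain ⟨f, hinj, hdist, hwt⟩ := ih
    have hpow : 2 ^ (k + 1) = 2 * 2 ^ k := by ring
    rw [hpow]
    refine ⟨fun i => if i < 2 ^ k then Fin.cons false (f i)
      else Fin.cons true (f (2 * 2 ^ k - 1 - i)), ?_, ?_, ?_⟩
    · intro i hi i' hi' h
      dsimp only at h
      split_ifs at h with h1 h2 h2
      · exact hinj i h1 i' h2 (Fin.cons_inj.1 h).2
      · exact absurd (Fin.cons_inj.1 h).1 (by decide)
      · exact absurd (Fin.cons_inj.1 h).1 (by decide)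
      · have := hinj _ (by omega) _ (by omega) (Fin.cons_inj.1 h).2
        omega
    · intro i hi
      dsimp only
      split_ifs with h1 h2 h2
      · simpa [hammingDist_cons] using hdist i h2
      · rw [show 2 * 2 ^ k - 1 - (i + 1) = i by omega]
        simp [hammingDist_cons]
      · omega
      · rw [hammingDist_comm, show 2 * 2 ^ k - 1 - i = 2 * 2 ^ k - 1 - (i + 1) + 1 by omega]
        simpa [hammingDist_cons] using hdist (2 * 2 ^ k - 1 - (i + 1)) (by omega)
    · intro i hi
      dsimp only
      split_ifs with h1
      · simpa [wt_cons] using hwt i h1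
      · have := hwt (2 * 2 ^ k - 1 - i) (by omega)
        rw [wt_cons, if_pos rfl]
        omega

theorem SimpleGraph.exists_isPath_of_adj_succ {V : Type*} {G : SimpleGraph V} (g : ℕ → V) (n : ℕ)
    (hadj : ∀ i < n, G.Adj (g i) (g (i + 1)))
    (hinj : ∀ i ≤ n, ∀ i' ≤ n, g i = g i' → i = i') :
    ∃ p : G.Walk (g 0) (g n), p.IsPath ∧ p.length = n ∧ ∀ v ∈ p.support, ∃ i ≤ n, g i = v := by
  induction n with
  | zero => exact ⟨.nil, by simp, by simp, fun v hv => ⟨0, le_rfl, by simpa [eq_comm] using hv⟩⟩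
  | succ n ih =>
    obtain ⟨p, hp, hlen, hsupp⟩ := ih (fun i hi => hadj i (by omega))
      (fun i hi i' hi' h => hinj i (by omega) i' (by omega) h)
    refine ⟨p.concat (hadj n (by omega)), hp.concat (fun hmem => ?_) _, by simp [hlen], ?_⟩
    · obtain ⟨i, hi, h⟩ := hsupp _ hmem
      have := hinj i (by omega) (n + 1) le_rfl h
      omega
    · intro v hv
      rw [Walk.support_concat, List.mem_append] at hv
      rcases hv with hv | hv
      · obtain ⟨i, hi, h⟩ := hsupp v hv
        exact ⟨i, by omega, h⟩
      · exact ⟨n + 1, le_rfl, (List.mem_singleton.1 hv).symm⟩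

theorem hypercube_adj_of_hammingDist_eq_one {k : ℕ} {u v : Fin k → Bool}
    (h : hammingDist u v = 1) : (hypercube k).Adj u v := by
  refine (fromRel_adj _ _ _).2 ⟨?_, Or.inl h⟩
  rintro rfl
  simp at h

/-- there is a set `C` of exactly `j` even-weight vertices of `Q_k`
whose deletion leaves a path of length `2^k - 2j`. -/
theorem stmt13 (k j : ℕ) (hk : 2 ≤ k) (hj0 : 0 < j) (hj : j ≤ 2 ^ (k - 1)) :
    ∃ C : Finset (Fin k → Bool), C.card = j ∧ (∀ v ∈ C, wt v % 2 = 0) ∧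
      ∃ (x y : {v : Fin k → Bool // v ∉ C})
        (p : ((hypercube k).induce {v : Fin k → Bool | v ∉ C}).Walk x y),
        p.IsPath ∧ p.length = 2 ^ k - 2 * j := by
  obtain ⟨f, hinj, hdist, hwt⟩ := exists_grayCode k
  have hpow : 2 ^ k = 2 * 2 ^ (k - 1) := by rw [← pow_succ']; congr 1; omega
  let C : Finset (Fin k → Bool) := (Finset.range j).image (fun m => f (2 * m))
  have hC : ∀ i, 2 * j - 1 ≤ i → i < 2 ^ k → f i ∉ C := by
    intro i hi hik hmem
    obtain ⟨m, hm, h⟩ := Finset.mem_image.1 hmem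
    rw [Finset.mem_range] at hm
    have := hinj (2 * m) (by omega) i hik h
    omega
  refine ⟨C, ?_, ?_, ?_⟩
  · rw [Finset.card_image_of_injOn, Finset.card_range]
    intro a ha b hb h
    simp only [Finset.coe_range, Set.mem_Iio] at ha hb
    have := hinj (2 * a) (by omega) (2 * b) (by omega) h
    omega
  · intro v hv
    obtain ⟨m, hm, rfl⟩ := Finset.mem_image.1 hv
    rw [Finset.mem_range] at hm
    rw [hwt (2 * m) (by omega)]
    omega
  · let g : ℕ → {v : Fin k → Bool // v ∉ C} := fun i =>
      ⟨f (min (2 * j - 1 + i) (2 ^ k - 1)), hC _ (by omega) (by omega)⟩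
    have hg : ∀ i ≤ 2 ^ k - 2 * j, (g i).1 = f (2 * j - 1 + i) := fun i hi =>
      congrArg f (min_eq_left (by omega))
    obtain ⟨p, hp, hlen, -⟩ := exists_isPath_of_adj_succ
      (G := (hypercube k).induce {v : Fin k → Bool | v ∉ C}) g (2 ^ k - 2 * j)
      (fun i hi => by
        rw [comap_adj]
        refine hypercube_adj_of_hammingDist_eq_one ?_
        change hammingDist (g i).1 (g (i + 1)).1 = 1
        rw [hg i (by omega), hg (i + 1) (by omega)]
        exact hdist (2 * j - 1 + i) (by omega))
      (fun i hi i' hi' h => by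
        have h' := congrArg Subtype.val h
        rw [hg i hi, hg i' hi'] at h'
        have := hinj _ (by omega) _ (by omega) h'
        omega)
    exact ⟨_, _, p, hp, hlen⟩
end
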